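/- Let N ≥ 1 and m > 1. Define v_* on the open unit ball B_1 ⊂ ℝ^N by v_*(x) = ((m-1)/(2m)·(1-|x|²))^{1/(m-1)}, and let θ = 2m²/((2m-1)(N(m-1)+1)). Then for every x ∈ B_1, θ·v_*(x)^{m-3/2}·Δ(v_*^{m-1/2})(x) = |x|²/2 - N(m-1)/(2(N(m-1)+1)). Consequently ∇(θ v_*^{m-3/2} Δ(v_*^{m-1/2}))(x) = x on B_1, so v_* is a stationary solution of the confined fourth-order equation ∂_t v - div(xv) + θ div(v∇(v^{m-3/2}Δ(v^{m-1/2}))) = 0; moreover ∇(v_*^{2m-2})(x) → 0 as |x| → 1, so the zero contact-angle condition holds on ∂B_1. -/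

import Mathlib

open MeasureTheory Real Filter ENNReal

noncomputable section

/-- The `i`-th partial derivative of `f` at `x`. -/
def pdv (N : ℕ) (f : EuclideanSpace ℝ (Fin N) → ℝ) (i : Fin N)
    (x : EuclideanSpace ℝ (Fin N)) : ℝ :=
  fderiv ℝ f x (EuclideanSpace.single i 1)

/-- The Laplacian of `f` at `x`. -/
def lap (N : ℕ) (f : EuclideanSpace ℝ (Fin N) → ℝ)
    (x : EuclideanSpace ℝ (Fin N)) : ℝ :=
  ∑ i, pdv N (pdv N f i) i x

/-- The porous medium displacement Hessian
`(H_E ψ)(x) = -((m-1)/2)(1-|x|²)Δψ(x) + x·∇ψ(x)`. -/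
def HE (N : ℕ) (m : ℝ) (f : EuclideanSpace ℝ (Fin N) → ℝ)
    (x : EuclideanSpace ℝ (Fin N)) : ℝ :=
  -((m - 1) / 2) * (1 - ‖x‖ ^ 2) * lap N f x + ∑ i, x i * pdv N f i x


/-- The Barenblatt profile `v_*(x) = ((m-1)/(2m)·(1-|x|²))^{1/(m-1)}` (for `m > 1`). -/
def vB (N : ℕ) (m : ℝ) (x : EuclideanSpace ℝ (Fin N)) : ℝ :=
  ((m - 1) / (2 * m) * (1 - ‖x‖ ^ 2)) ^ (1 / (m - 1))

theorem hasFDerivAt_one_sub_norm_sq_rpow {N : ℕ} (p : ℝ) {x : EuclideanSpace ℝ (Fin N)}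
    (hx : ‖x‖ < 1) :
    HasFDerivAt (fun y : EuclideanSpace ℝ (Fin N) => (1 - ‖y‖ ^ 2) ^ p)
      ((-(2 * p) * (1 - ‖x‖ ^ 2) ^ (p - 1)) • innerSL ℝ x) x := by
  have hs : 0 < 1 - ‖x‖ ^ 2 := by nlinarith [norm_nonneg x]
  have h := ((hasStrictFDerivAt_norm_sq x).hasFDerivAt.const_sub 1).rpow_const (p := p)
    (Or.inl hs.ne')
  refine h.congr_fderiv ?_
  ext y
  simp
  ring

theorem hasFDerivAt_coord {N : ℕ} (i : Fin N) (x : EuclideanSpace ℝ (Fin N)) :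
    HasFDerivAt (fun y : EuclideanSpace ℝ (Fin N) => y i)
      (EuclideanSpace.proj i : EuclideanSpace ℝ (Fin N) →L[ℝ] ℝ) x :=
  (EuclideanSpace.proj i : EuclideanSpace ℝ (Fin N) →L[ℝ] ℝ).hasFDerivAt

theorem eventually_norm_lt_one {E : Type*} [SeminormedAddCommGroup E] {x : E}
    (hx : ‖x‖ < 1) : ∀ᶠ y in nhds x, ‖y‖ < 1 :=
  continuous_norm.continuousAt.eventually (gt_mem_nhds hx)

theorem pdv_const_mul_one_sub_norm_sq_rpow {N : ℕ} (c p : ℝ) {f : EuclideanSpace ℝ (Fin N) → ℝ}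
    (hf : ∀ y, ‖y‖ < 1 → f y = c * (1 - ‖y‖ ^ 2) ^ p) (i : Fin N)
    {x : EuclideanSpace ℝ (Fin N)} (hx : ‖x‖ < 1) :
    pdv N f i x = -(2 * p * c) * (x i * (1 - ‖x‖ ^ 2) ^ (p - 1)) := by
  have he : f =ᶠ[nhds x] fun y => c * (1 - ‖y‖ ^ 2) ^ p :=
    (eventually_norm_lt_one hx).mono hf
  rw [pdv, he.fderiv_eq, ((hasFDerivAt_one_sub_norm_sq_rpow p hx).const_mul c).fderiv]
  simp [EuclideanSpace.inner_single_right]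
  ring

theorem lap_const_mul_one_sub_norm_sq_rpow {N : ℕ} (c p : ℝ) {f : EuclideanSpace ℝ (Fin N) → ℝ}
    (hf : ∀ y, ‖y‖ < 1 → f y = c * (1 - ‖y‖ ^ 2) ^ p)
    {x : EuclideanSpace ℝ (Fin N)} (hx : ‖x‖ < 1) :
    lap N f x = 4 * p * (p - 1) * c * ‖x‖ ^ 2 * (1 - ‖x‖ ^ 2) ^ (p - 2)
      - 2 * N * p * c * (1 - ‖x‖ ^ 2) ^ (p - 1) := by
  have key : ∀ i : Fin N, pdv N (pdv N f i) i x =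
      4 * p * (p - 1) * c * (1 - ‖x‖ ^ 2) ^ (p - 2) * x i ^ 2
        - 2 * p * c * (1 - ‖x‖ ^ 2) ^ (p - 1) := by
    intro i
    have he : pdv N f i =ᶠ[nhds x]
        fun y => -(2 * p * c) * (y i * (1 - ‖y‖ ^ 2) ^ (p - 1)) :=
      (eventually_norm_lt_one hx).mono fun y hy =>
        pdv_const_mul_one_sub_norm_sq_rpow c p hf i hy
    have hd := ((hasFDerivAt_coord i x).fun_mul
      (hasFDerivAt_one_sub_norm_sq_rpow (p - 1) hx)).const_mul (-(2 * p * c))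
    rw [pdv, he.fderiv_eq, hd.fderiv, show p - 1 - 1 = p - 2 by ring]
    simp [EuclideanSpace.inner_single_right]
    ring
  rw [lap, Finset.sum_congr rfl fun i _ => key i, Finset.sum_sub_distrib, ← Finset.mul_sum,
    ← EuclideanSpace.real_norm_sq_eq]
  simp
  ring

theorem vB_rpow {N : ℕ} {m : ℝ} (hm : 1 < m) (q : ℝ) {x : EuclideanSpace ℝ (Fin N)}
    (hx : ‖x‖ < 1) :
    vB N m x ^ q =
      ((m - 1) / (2 * m)) ^ (q / (m - 1)) * (1 - ‖x‖ ^ 2) ^ (q / (m - 1)) := by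
  have hs : 0 < 1 - ‖x‖ ^ 2 := by nlinarith [norm_nonneg x]
  have ha : 0 < (m - 1) / (2 * m) := div_pos (by linarith) (by linarith)
  rw [vB, ← Real.rpow_mul (mul_pos ha hs).le, Real.mul_rpow ha.le hs.le, one_div_mul_eq_div]

/-- The pressure `v_*^{m-3/2} Δ(v_*^{m-1/2})` of the Barenblatt profile is quadratic. -/
theorem vB_rpow_mul_lap {N : ℕ} {m : ℝ} (hm : 1 < m) {x : EuclideanSpace ℝ (Fin N)}
    (hx : ‖x‖ < 1) :
    vB N m x ^ (m - 3 / 2) * lap N (fun y => vB N m y ^ (m - 1 / 2)) x =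
      (2 * m - 1) / (4 * m ^ 2) * (‖x‖ ^ 2 - N * (m - 1) * (1 - ‖x‖ ^ 2)) := by
  have hs : 0 < 1 - ‖x‖ ^ 2 := by nlinarith [norm_nonneg x]
  have ha : 0 < (m - 1) / (2 * m) := div_pos (by linarith) (by linarith)
  have hm1 : m - 1 ≠ 0 := by linarith
  have hm0 : m ≠ 0 := by linarith
  rw [lap_const_mul_one_sub_norm_sq_rpow _ _ (fun y hy => vB_rpow hm (m - 1 / 2) hy) hx,
    vB_rpow hm _ hx]
  have hq : (m - 3 / 2) / (m - 1) = 2 - (m - 1 / 2) / (m - 1) := by field_simp; ring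
  have hp1 : (m - 1 / 2) / (m - 1) - 1 = 1 / (2 * (m - 1)) := by field_simp; ring
  rw [hq]
  have hp : (m - 1 / 2) / (m - 1) = (2 * m - 1) / (2 * (m - 1)) := by field_simp
  set p := (m - 1 / 2) / (m - 1) with hpdef
  set a := (m - 1) / (2 * m) with hadef
  set s := 1 - ‖x‖ ^ 2 with hsdef
  have h1 : a ^ (2 - p) * a ^ p = a ^ 2 := by
    rw [← Real.rpow_add ha]; norm_num
  have h2 : s ^ (2 - p) * s ^ (p - 2) = 1 := by
    rw [← Real.rpow_add hs]; norm_num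
  have h3 : s ^ (2 - p) * s ^ (p - 1) = s := by
    rw [← Real.rpow_add hs, show 2 - p + (p - 1) = 1 by ring, Real.rpow_one]
  calc _ = (a ^ (2 - p) * a ^ p) * (4 * p * (p - 1) * ‖x‖ ^ 2 * (s ^ (2 - p) * s ^ (p - 2))
          - 2 * N * p * (s ^ (2 - p) * s ^ (p - 1))) := by ring
    _ = _ := by
      rw [h1, h2, h3, hp1, hp, hadef]
      field_simp
      ring

theorem hasGradientAt_half_norm_sq_sub_const {E : Type*} [NormedAddCommGroup E]
    [InnerProductSpace ℝ E] [CompleteSpace E] (b : ℝ) (x : E) :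
    HasGradientAt (fun y : E => ‖y‖ ^ 2 / 2 - b) x x := by
  have h := ((hasStrictFDerivAt_norm_sq x).hasFDerivAt.mul_const (1 / 2 : ℝ)).sub_const b
  rw [hasGradientAt_iff_hasFDerivAt]
  have h' : HasFDerivAt (fun y : E => ‖y‖ ^ 2 / 2 - b) _ x :=
    h.congr_of_eventuallyEq (Eventually.of_forall fun y => by simp [div_eq_mul_inv])
  refine h'.congr_fderiv ?_
  ext y
  simp

theorem gradient_vB_rpow {N : ℕ} {m : ℝ} (hm : 1 < m) {x : EuclideanSpace ℝ (Fin N)}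
    (hx : ‖x‖ < 1) :
    gradient (fun y => vB N m y ^ (2 * m - 2)) x =
      (-4 * ((m - 1) / (2 * m)) ^ 2 * (1 - ‖x‖ ^ 2)) • x := by
  have hq : (2 * m - 2) / (m - 1) = 2 := by
    rw [div_eq_iff (by linarith)]; ring
  have he : (fun y => vB N m y ^ (2 * m - 2)) =ᶠ[nhds x]
      fun y => ((m - 1) / (2 * m)) ^ (2 : ℝ) * (1 - ‖y‖ ^ 2) ^ (2 : ℝ) :=
    (eventually_norm_lt_one hx).mono fun y hy => by
      have := vB_rpow hm (2 * m - 2) hy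
      rwa [hq] at this
  apply HasGradientAt.gradient
  rw [hasGradientAt_iff_hasFDerivAt]
  refine (((hasFDerivAt_one_sub_norm_sq_rpow 2 hx).const_mul _).congr_of_eventuallyEq
    he).congr_fderiv ?_
  ext y
  norm_num [inner_smul_left]
  ring

/-- For `m > 1` and `θ = 2m²/((2m-1)(N(m-1)+1))`, on the unit ball
`θ v_*^{m-3/2} Δ(v_*^{m-1/2}) = |x|²/2 - N(m-1)/(2(N(m-1)+1))`, hence
`∇(θ v_*^{m-3/2} Δ(v_*^{m-1/2})) = x` on `B_1` (so `v_*` is a stationary solution of the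
confined fourth-order equation), and `∇(v_*^{2m-2})(x) → 0` as `|x| → 1` (zero contact
angle). -/
theorem stmt14 (N : ℕ) (hN : 1 ≤ N) (m : ℝ) (hm : 1 < m)
    (θ : ℝ) (hθ : θ = 2 * m ^ 2 / ((2 * m - 1) * ((N : ℝ) * (m - 1) + 1))) :
    (∀ x : EuclideanSpace ℝ (Fin N), ‖x‖ < 1 →
      θ * (vB N m x) ^ (m - 3 / 2) * lap N (fun y => (vB N m y) ^ (m - 1 / 2)) x
        = ‖x‖ ^ 2 / 2 - (N : ℝ) * (m - 1) / (2 * ((N : ℝ) * (m - 1) + 1))) ∧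
    (∀ x : EuclideanSpace ℝ (Fin N), ‖x‖ < 1 →
      gradient (fun y =>
        θ * (vB N m y) ^ (m - 3 / 2) * lap N (fun z => (vB N m z) ^ (m - 1 / 2)) y) x = x) ∧
    (∀ x₀ : EuclideanSpace ℝ (Fin N), ‖x₀‖ = 1 →
      Tendsto (fun x => gradient (fun y => (vB N m y) ^ (2 * m - 2)) x)
        (nhdsWithin x₀ (Metric.ball 0 1)) (nhds 0)) := by
  have hpos : 0 < (N : ℝ) * (m - 1) + 1 := by
    have : (0 : ℝ) ≤ N * (m - 1) := mul_nonneg N.cast_nonneg (by linarith)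
    linarith
  have hquad : ∀ x : EuclideanSpace ℝ (Fin N), ‖x‖ < 1 →
      θ * (vB N m x) ^ (m - 3 / 2) * lap N (fun y => (vB N m y) ^ (m - 1 / 2)) x
        = ‖x‖ ^ 2 / 2 - (N : ℝ) * (m - 1) / (2 * ((N : ℝ) * (m - 1) + 1)) := by
    intro x hx
    have h0 : m ≠ 0 := by linarith
    have h1 : 2 * m - 1 ≠ 0 := by linarith
    rw [mul_assoc, vB_rpow_mul_lap hm hx, hθ]
    field_simp
    ring
  refine ⟨hquad, fun x hx => ?_, fun x₀ hx₀ => ?_⟩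
  · exact ((hasGradientAt_half_norm_sq_sub_const _ x).congr_of_eventuallyEq
      ((eventually_norm_lt_one hx).mono hquad)).gradient
  · have hc : Continuous fun x : EuclideanSpace ℝ (Fin N) =>
        (-4 * ((m - 1) / (2 * m)) ^ 2 * (1 - ‖x‖ ^ 2)) • x := by fun_prop
    have ht := (hc.tendsto x₀).mono_left (nhdsWithin_le_nhds (s := Metric.ball 0 1))
    simp only [hx₀, one_pow, sub_self, mul_zero, zero_smul] at ht
    refine ht.congr' ?_
    filter_upwards [self_mem_nhdsWithin] with x hx
    exact (gradient_vB_rpow hm (by simpa using hx)).symm
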